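/- arXiv:2507.17378 — 2 statements merged into one kernel-verified Lean document; each statement's English description precedes it below -/
import Mathlib

section
/- Let a < b and let w : ℝ → ℝ be continuously differentiable on [a,b]. Let ℓ(t) = w(a) + (w(b) − w(a))·(t − a)/(b − a) be the linear interpolant of w on [a,b]. Then ∫_a^b (w(t) − ℓ(t))² dt ≤ (b − a)² ∫_a^b (w'(t) − ℓ'(t))² dt. -/
open intervalIntegral Set

/-- A Poincaré inequality on `[a, b]` for functions vanishing at both endpoints. -/
theorem integral_sq_le_of_eq_zero_endpoints {a b : ℝ} (hab : a ≤ b) {e e' : ℝ → ℝ}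
    (he : ∀ t ∈ Icc a b, HasDerivWithinAt e (e' t) (Icc a b) t)
    (he' : ContinuousOn e' (Icc a b)) (ha : e a = 0) (hb : e b = 0) :
    ∫ t in a..b, e t ^ 2 ≤ (b - a) ^ 2 * ∫ t in a..b, e' t ^ 2 := by
  have hc : ContinuousOn e (Icc a b) := fun t ht => (he t ht).continuousWithinAt
  -- `D` is the derivative of `t ↦ (t - (a + b) / 2) * e t ^ 2`, so its integral vanishes.
  let D : ℝ → ℝ := fun t => e t ^ 2 + 2 * (t - (a + b) / 2) * e t * e' t
  have hDc : ContinuousOn D (Icc a b) := by fun_prop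
  have hDi : IntervalIntegrable D MeasureTheory.volume a b :=
    hDc.intervalIntegrable_of_Icc hab
  have hD : ∫ t in a..b, D t = 0 := by
    rw [integral_eq_sub_of_hasDerivAt_of_le (f := fun t => (t - (a + b) / 2) * e t ^ 2) hab
      (by fun_prop) _ hDi]
    · simp [ha, hb]
    · intro t ht
      have h := (he t (Ioo_subset_Icc_self ht)).hasDerivAt (Icc_mem_nhds ht.1 ht.2)
      refine (((hasDerivAt_id' t).sub_const ((a + b) / 2)).fun_mul (h.fun_pow 2)).congr_deriv ?_
      simp [D]
      ring
  have hei : IntervalIntegrable (fun t => e t ^ 2) MeasureTheory.volume a b :=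
    (hc.pow 2).intervalIntegrable_of_Icc hab
  have hei' : IntervalIntegrable (fun t => (b - a) ^ 2 * e' t ^ 2) MeasureTheory.volume a b :=
    ((he'.pow 2).intervalIntegrable_of_Icc hab).const_mul _
  calc ∫ t in a..b, e t ^ 2
      ≤ ∫ t in a..b, (2 * D t + (b - a) ^ 2 * e' t ^ 2) := by
        refine integral_mono_on hab hei ((hDi.const_mul 2).add hei') fun t ht => ?_
        have h : 0 ≤ (t - a) * (b - t) * e' t ^ 2 :=
          mul_nonneg (mul_nonneg (sub_nonneg.2 ht.1) (sub_nonneg.2 ht.2)) (sq_nonneg _)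
        simp only [D]
        linarith [sq_nonneg (e t + 2 * (t - (a + b) / 2) * e' t)]
    _ = (b - a) ^ 2 * ∫ t in a..b, e' t ^ 2 := by
        rw [integral_add (hDi.const_mul 2) hei', integral_const_mul, integral_const_mul, hD]
        ring

/-- L² interpolation error estimate for linear interpolation on one grid interval:
if `ℓ` is the affine interpolant of `w` at the endpoints of `[a,b]`, then
`∫_a^b (w − ℓ)² ≤ (b − a)² ∫_a^b (w' − ℓ')²`, where `ℓ' = (w(b) − w(a))/(b − a)`. -/
theorem linear_interpolation_L2_error
    (a b : ℝ) (hab : a < b) (w w' : ℝ → ℝ)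
    (hw : ∀ t ∈ Set.Icc a b, HasDerivWithinAt w (w' t) (Set.Icc a b) t)
    (hw' : ContinuousOn w' (Set.Icc a b))
    (ℓ : ℝ → ℝ) (hℓ : ∀ t, ℓ t = w a + (w b - w a) * (t - a) / (b - a)) :
    (∫ t in a..b, (w t - ℓ t) ^ 2) ≤
      (b - a) ^ 2 * ∫ t in a..b, (w' t - (w b - w a) / (b - a)) ^ 2 := by
  have hne : b - a ≠ 0 := (sub_pos.2 hab).ne'
  have hℓ' : ∀ t, HasDerivAt ℓ ((w b - w a) / (b - a)) t := fun t => by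
    rw [funext hℓ]
    simpa using ((((hasDerivAt_id t).sub_const a).const_mul (w b - w a)).div_const
      (b - a)).const_add (w a)
  refine integral_sq_le_of_eq_zero_endpoints (e := fun t => w t - ℓ t) hab.le
    (fun t ht => (hw t ht).fun_sub (hℓ' t).hasDerivWithinAt) (hw'.sub continuousOn_const) ?_ ?_
  · simp [hℓ]
  · simp [hℓ, hne]
end

section
/- Let N ≥ 2 be an integer, τ > 0, and v : {0,1,…,N} → ℝ. Define the recovered derivative values of the polynomial preserving recovery on a uniform grid with step τ by g_0 = (−3v_0 + 4v_1 − v_2)/(2τ), g_i = (v_{i+1} − v_{i−1})/(2τ) for 1 ≤ i ≤ N−1, and g_N = (3v_N − 4v_{N−1} + v_{N−2})/(2τ), and let d_i = (v_i − v_{i−1})/τ for 1 ≤ i ≤ N. Then ∑_{i=0}^{N} g_i² ≤ 6 ∑_{i=1}^{N} d_i². -/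
open Finset

/-- Discrete boundedness of the PPR gradient recovery operator on a uniform grid:
with recovered values `g_0 = (−3v_0 + 4v_1 − v_2)/(2τ)`,
`g_i = (v_{i+1} − v_{i−1})/(2τ)` for `1 ≤ i ≤ N−1`,
`g_N = (3v_N − 4v_{N−1} + v_{N−2})/(2τ)`, and backward difference quotients
`d_i = (v_i − v_{i−1})/τ`, one has `∑_{i=0}^{N} g_i² ≤ 6 ∑_{i=1}^{N} d_i²`. -/
theorem ppr_discrete_boundedness
    (N : ℕ) (hN : 2 ≤ N) (τ : ℝ) (hτ : 0 < τ) (v : ℕ → ℝ)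
    (g : ℕ → ℝ)
    (hg0 : g 0 = (-3 * v 0 + 4 * v 1 - v 2) / (2 * τ))
    (hgI : ∀ i, 1 ≤ i → i ≤ N - 1 → g i = (v (i + 1) - v (i - 1)) / (2 * τ))
    (hgN : g N = (3 * v N - 4 * v (N - 1) + v (N - 2)) / (2 * τ))
    (d : ℕ → ℝ) (hd : ∀ i, 1 ≤ i → i ≤ N → d i = (v i - v (i - 1)) / τ) :
    ∑ i ∈ Finset.range (N + 1), (g i) ^ 2 ≤ 6 * ∑ i ∈ Finset.Icc 1 N, (d i) ^ 2 := by
  obtain ⟨M, rfl⟩ : ∃ M, N = M + 2 := ⟨N - 2, by omega⟩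
  have hdiff : ∀ i, i ≤ M + 1 → d (i + 1) = (v (i + 1) - v i) / τ := fun i hi ↦
    hd (i + 1) (by omega) (by omega)
  have hleft : g 0 = (3 * d 1 - d 2) / 2 := by
    rw [hg0, hdiff 0 (by omega), hdiff 1 (by omega)]
    field_simp
    ring
  have hright : g (M + 2) = (3 * d (M + 2) - d (M + 1)) / 2 := by
    rw [hgN, hdiff (M + 1) (by omega), hdiff M (by omega),
      show M + 2 - 1 = M + 1 by omega, show M + 2 - 2 = M by omega]
    field_simp
    ring
  have hinterior : ∀ i ∈ range (M + 1), g (i + 1) ^ 2 ≤ (d (i + 1) ^ 2 + d (i + 2) ^ 2) / 2 := by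
    intro i hi
    have hi' := mem_range.mp hi
    have hmean : g (i + 1) = (d (i + 1) + d (i + 2)) / 2 := by
      rw [hgI (i + 1) (by omega) (by omega), hdiff i (by omega), hdiff (i + 1) (by omega),
        Nat.add_sub_cancel]
      field_simp
      ring
    rw [hmean]
    nlinarith [sq_nonneg (d (i + 1) - d (i + 2))]
  have hsum : ∑ i ∈ Icc 1 (M + 2), d i ^ 2 = ∑ i ∈ range (M + 2), d (i + 1) ^ 2 := by
    rw [range_eq_Ico, sum_Ico_add' (fun i ↦ d i ^ 2) 0 (M + 2) 1]
    rfl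
  have hsum_init := sum_range_succ (fun i ↦ d (i + 1) ^ 2) (M + 1)
  have hsum_tail := sum_range_succ' (fun i ↦ d (i + 1) ^ 2) (M + 1)
  have hsum_init₂ := sum_range_succ (fun i ↦ d (i + 1) ^ 2) M
  have hsum_tail₂ := sum_range_succ' (fun i ↦ d (i + 1 + 1) ^ 2) M
  have hnonneg_init : 0 ≤ ∑ i ∈ range M, d (i + 1) ^ 2 := sum_nonneg fun _ _ ↦ sq_nonneg _
  have hnonneg_tail : 0 ≤ ∑ i ∈ range M, d (i + 1 + 1 + 1) ^ 2 :=
    sum_nonneg fun _ _ ↦ sq_nonneg _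
  have hbound := sum_le_sum hinterior
  rw [← sum_div, sum_add_distrib] at hbound
  rw [hsum, sum_range_succ, sum_range_succ', hleft, hright]
  simp only [add_assoc, Nat.reduceAdd, zero_add] at *
  nlinarith [sq_nonneg (d 1 + 3 * d 2), sq_nonneg (d (M + 2) + 3 * d (M + 1)),
    sq_nonneg (d 1), sq_nonneg (d (M + 2))]
end
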